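/- (One-variable case of Theorem 1.2: variance of normalized zero statistics is O(1/N²).) There is a constant C > 0 with the following property. Let U ⊆ ℂ be open, and for each N ≥ 1 let n_N ≥ 1 and let p_{N,1}, …, p_{N,n_N} ∈ ℂ[z] be polynomials of degree at most N having no common zero in U. For c ∈ ℂ^{n_N} set f_{N,c} = ∑_{j=1}^{n_N} c_j p_{N,j}. Then for every smooth function φ : ℂ → ℝ with compact support contained in U and every N ≥ 1, the random variable X_N(c) := (1/N) ∑_{a ∈ Z(f_{N,c})} φ(a), with c distributed according to γ_{n_N}, satisfies Var(X_N) ≤ (C/N²) · ( ∫_ℂ |Δφ(z)| dλ(z) )². -/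

import Mathlib

open MeasureTheory

noncomputable instance (n : ℕ) : MeasurableSpace (EuclideanSpace ℂ (Fin n)) := borel _
instance (n : ℕ) : BorelSpace (EuclideanSpace ℂ (Fin n)) := ⟨rfl⟩

/-- The standard complex Gaussian measure `γₙ` on `ℂⁿ`, with density
`c ↦ π⁻ⁿ exp(-‖c‖²)` with respect to Lebesgue measure on `ℂⁿ ≅ ℝ²ⁿ`. -/
noncomputable def gammaC (n : ℕ) : Measure (EuclideanSpace ℂ (Fin n)) :=
  volume.withDensity fun c => ENNReal.ofReal ((Real.pi ^ n)⁻¹ * Real.exp (-‖c‖ ^ 2))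


/-- The Laplacian `Δφ = ∂²φ/∂x² + ∂²φ/∂y²` of a function `φ : ℂ → ℝ`. -/
noncomputable def lap (φ : ℂ → ℝ) (z : ℂ) : ℝ :=
  iteratedFDeriv ℝ 2 φ z ![1, 1] + iteratedFDeriv ℝ 2 φ z ![Complex.I, Complex.I]

open Filter Topology

/-- The squared logarithm is controlled by `r⁻¹ + r`. -/
lemma sq_log_le {r : ℝ} (hr : 0 ≤ r) : Real.log r ^ 2 ≤ 4 * (r⁻¹ + r) := by
  rcases hr.eq_or_lt with rfl | hr
  · simp
  have hs : 0 < √r := Real.sqrt_pos.2 hr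
  have h1 : Real.log r = 2 * Real.log √r := by rw [Real.log_sqrt hr.le]; ring
  have h2 : Real.log √r ≤ √r := (Real.log_le_sub_one_of_pos hs).trans (by linarith)
  have h3 : -Real.log √r ≤ (√r)⁻¹ := by
    rw [← Real.log_inv]
    exact (Real.log_le_sub_one_of_pos (inv_pos.2 hs)).trans (by linarith)
  have h4 : √r ^ 2 = r := Real.sq_sqrt hr.le
  have h5 : (√r)⁻¹ ^ 2 = r⁻¹ := by rw [inv_pow, h4]
  have h6 : 0 < (√r)⁻¹ := inv_pos.2 hs
  rw [h1]
  rcases le_total 0 (Real.log √r) with h | h <;> nlinarith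

lemma integrable_norm_rpow_mul_exp_neg_sq {q : ℝ} (hq : -2 < q) :
    Integrable fun z : ℂ ↦ ‖z‖ ^ q * Real.exp (-‖z‖ ^ 2) := by
  by_contra h
  have h1 := Complex.integral_rpow_mul_exp_neg_rpow (p := 2) (by norm_num) hq
  simp only [Real.rpow_two] at h1
  rw [integral_undef h] at h1
  have : 0 < Real.Gamma ((q + 2) / 2) := Real.Gamma_pos_of_pos (by linarith)
  have := Real.pi_pos
  exact absurd h1 (by positivity)

lemma integrable_sq_log_norm_mul_exp_neg_sq :
    Integrable fun z : ℂ ↦ Real.log ‖z‖ ^ 2 * Real.exp (-‖z‖ ^ 2) := by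
  have h := ((integrable_norm_rpow_mul_exp_neg_sq (q := -1) (by norm_num)).add
    (integrable_norm_rpow_mul_exp_neg_sq (q := 1) (by norm_num))).const_mul 4
  refine h.mono' (by fun_prop) (.of_forall fun z ↦ ?_)
  rw [Real.norm_of_nonneg (by positivity)]
  have := mul_le_mul_of_nonneg_right (sq_log_le (norm_nonneg z)) (Real.exp_nonneg (-‖z‖ ^ 2))
  simp only [Pi.add_apply, Real.rpow_neg_one, Real.rpow_one]
  linarith

lemma integrable_exp_neg_sq : Integrable fun z : ℂ ↦ Real.exp (-‖z‖ ^ 2) := by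
  simpa using integrable_norm_rpow_mul_exp_neg_sq (q := 0) (by norm_num)

/-- The logarithmic singularity is integrable against continuous compactly supported functions. -/
lemma integrable_log_norm_sub_mul {g : ℂ → ℝ} (hg : Continuous g) (hgs : HasCompactSupport g)
    (a : ℂ) : Integrable fun z ↦ Real.log ‖z - a‖ * g z := by
  have hc : Continuous fun z ↦ Real.exp (‖z - a‖ ^ 2) * g z := by fun_prop
  obtain ⟨M, hM⟩ := (hgs.mul_left (f := fun z ↦ Real.exp (‖z - a‖ ^ 2))).exists_bound_of_continuous
    hc
  have h := ((integrable_sq_log_norm_mul_exp_neg_sq.add integrable_exp_neg_sq).const_mul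
    M).comp_sub_right a
  refine h.mono' ((Real.measurable_log.comp (by fun_prop)).aestronglyMeasurable.mul
    hg.aestronglyMeasurable) (.of_forall fun z ↦ ?_)
  have h1 := hM z
  have h2 : |Real.log ‖z - a‖| ≤ Real.log ‖z - a‖ ^ 2 + 1 := by
    rw [← sq_abs]; nlinarith [sq_nonneg (|Real.log ‖z - a‖| - 1)]
  have h3 : |g z| = Real.exp (-‖z - a‖ ^ 2) * ‖Real.exp (‖z - a‖ ^ 2) * g z‖ := by
    rw [norm_mul, Real.norm_eq_abs, Real.abs_exp, ← mul_assoc, ← Real.exp_add]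
    simp
  simp only [Pi.add_apply]
  rw [norm_mul, Real.norm_eq_abs, Real.norm_eq_abs, h3]
  calc _ ≤ (Real.log ‖z - a‖ ^ 2 + 1) * (Real.exp (-‖z - a‖ ^ 2) * M) := by gcongr; exact h1
    _ = _ := by ring

/-- Double integration by parts in a fixed direction against a smooth compactly supported
function. -/
lemma integral_mul_fderiv_fderiv {u u₁ u₂ φ : ℂ → ℝ} {v : ℂ} (hφ : ContDiff ℝ (⊤ : ℕ∞) φ)
    (hφs : HasCompactSupport φ) (hu : Continuous u) (hu₁ : Continuous u₁) (hu₂ : Continuous u₂)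
    (hd : ∀ z, HasLineDerivAt ℝ u (u₁ z) z v) (hd₁ : ∀ z, HasLineDerivAt ℝ u₁ (u₂ z) z v) :
    ∫ z, u z * fderiv ℝ (fun w ↦ fderiv ℝ φ w v) z v = ∫ z, u₂ z * φ z := by
  have hφ1 : ContDiff ℝ (⊤ : ℕ∞) fun w ↦ fderiv ℝ φ w v :=
    (hφ.fderiv_right (m := (⊤ : ℕ∞)) (by simp)).clm_apply contDiff_const
  have hφ2 : ContDiff ℝ (⊤ : ℕ∞) fun w ↦ fderiv ℝ (fun w ↦ fderiv ℝ φ w v) w v :=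
    (hφ1.fderiv_right (m := (⊤ : ℕ∞)) (by simp)).clm_apply contDiff_const
  have hs1 : HasCompactSupport fun w ↦ fderiv ℝ φ w v := hφs.fderiv_apply ℝ v
  have hs2 : HasCompactSupport fun w ↦ fderiv ℝ (fun w ↦ fderiv ℝ φ w v) w v :=
    hs1.fderiv_apply ℝ v
  have key {f g : ℂ → ℝ} (hf : Continuous f) (hg : Continuous g) (hgs : HasCompactSupport g) :
      Integrable fun z ↦ f z * g z :=
    (hf.mul hg).integrable_of_hasCompactSupport (hgs.mul_left (f := f))
  have e1 := integral_bilinear_hasLineDerivAt_right_eq_neg_left_of_integrable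
    (μ := volume) (B := ContinuousLinearMap.mul ℝ ℝ) (f := u) (f' := u₁)
    (g := fun w ↦ fderiv ℝ φ w v) (g' := fun w ↦ fderiv ℝ (fun w ↦ fderiv ℝ φ w v) w v) (v := v)
    (key hu₁ hφ1.continuous hs1) (key hu hφ2.continuous hs2) (key hu hφ1.continuous hs1)
    (fun z _ ↦ hd z)
    (fun z _ ↦ ((hφ1.differentiable (by simp)) z).hasFDerivAt.hasLineDerivAt v)
  have e2 := integral_bilinear_hasLineDerivAt_right_eq_neg_left_of_integrable
    (μ := volume) (B := ContinuousLinearMap.mul ℝ ℝ) (f := u₁) (f' := u₂)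
    (g := φ) (g' := fun w ↦ fderiv ℝ φ w v) (v := v)
    (key hu₂ hφ.continuous hφs) (key hu₁ hφ1.continuous hs1) (key hu₁ hφ.continuous hφs)
    (fun z _ ↦ hd₁ z)
    (fun z _ ↦ ((hφ.differentiable (by simp)) z).hasFDerivAt.hasLineDerivAt v)
  simp only [ContinuousLinearMap.mul_apply'] at e1 e2
  rw [e1, e2, neg_neg]

lemma lap_eq {φ : ℂ → ℝ} (hφ : ContDiff ℝ (⊤ : ℕ∞) φ) (z : ℂ) :
    lap φ z = fderiv ℝ (fun w ↦ fderiv ℝ φ w 1) z 1 +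
      fderiv ℝ (fun w ↦ fderiv ℝ φ w Complex.I) z Complex.I := by
  have h : DifferentiableAt ℝ (fderiv ℝ φ) z :=
    ((hφ.fderiv_right (m := (⊤ : ℕ∞)) (by simp)).differentiable (by simp)) z
  simp only [lap, iteratedFDeriv_two_apply]
  rw [fderiv_clm_apply h (by fun_prop), fderiv_clm_apply h (by fun_prop)]
  simp

lemma continuous_lap {φ : ℂ → ℝ} (hφ : ContDiff ℝ (⊤ : ℕ∞) φ) : Continuous (lap φ) := by
  have h := hφ.continuous_iteratedFDeriv (m := 2) (WithTop.coe_le_coe.2 (le_top (a := (2 : ℕ∞))))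
  unfold lap
  fun_prop

lemma tsupport_lap_subset (φ : ℂ → ℝ) : tsupport (lap φ) ⊆ tsupport φ := by
  refine closure_minimal (fun z hz ↦ ?_) (isClosed_tsupport φ)
  by_contra h
  refine hz ?_
  have : iteratedFDeriv ℝ 2 φ z = 0 := by
    by_contra h'
    exact h (support_iteratedFDeriv_subset (𝕜 := ℝ) 2 h')
  simp [lap, this]

lemma HasCompactSupport.lap {φ : ℂ → ℝ} (hφ : HasCompactSupport φ) :
    HasCompactSupport (lap φ) :=
  hφ.of_isClosed_subset (isClosed_tsupport _) (tsupport_lap_subset φ)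

lemma integral_lap {φ : ℂ → ℝ} (hφ : ContDiff ℝ (⊤ : ℕ∞) φ) (hφs : HasCompactSupport φ)
    {u : ℂ → ℝ} {u₁ u₂ : ℂ → ℂ → ℝ} (hu : Continuous u) (hu₁ : ∀ v, Continuous (u₁ v))
    (hu₂ : ∀ v, Continuous (u₂ v)) (hd : ∀ v z, HasLineDerivAt ℝ u (u₁ v z) z v)
    (hd₁ : ∀ v z, HasLineDerivAt ℝ (u₁ v) (u₂ v z) z v) :
    ∫ z, u z * lap φ z = ∫ z, (u₂ 1 z + u₂ Complex.I z) * φ z := by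
  have hs (v : ℂ) : Integrable fun z ↦ u z * fderiv ℝ (fun w ↦ fderiv ℝ φ w v) z v := by
    have hφ1 : ContDiff ℝ (⊤ : ℕ∞) fun w ↦ fderiv ℝ φ w v :=
      (hφ.fderiv_right (m := (⊤ : ℕ∞)) (by simp)).clm_apply contDiff_const
    have hφ2 : ContDiff ℝ (⊤ : ℕ∞) fun w ↦ fderiv ℝ (fun w ↦ fderiv ℝ φ w v) w v :=
      (hφ1.fderiv_right (m := (⊤ : ℕ∞)) (by simp)).clm_apply contDiff_const
    exact (hu.mul hφ2.continuous).integrable_of_hasCompactSupport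
      (((hφs.fderiv_apply ℝ v).fderiv_apply ℝ v).mul_left (f := u))
  have hs2 (v : ℂ) : Integrable fun z ↦ u₂ v z * φ z :=
    ((hu₂ v).mul hφ.continuous).integrable_of_hasCompactSupport (hφs.mul_left (f := u₂ v))
  simp_rw [lap_eq hφ, mul_add, add_mul]
  rw [integral_add (hs 1) (hs Complex.I), integral_add (hs2 1) (hs2 Complex.I),
    integral_mul_fderiv_fderiv hφ hφs hu (hu₁ 1) (hu₂ 1) (hd 1) (hd₁ 1),
    integral_mul_fderiv_fderiv hφ hφs hu (hu₁ _) (hu₂ _) (hd Complex.I) (hd₁ Complex.I)]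

lemma integral_lap_eq_zero {φ : ℂ → ℝ} (hφ : ContDiff ℝ (⊤ : ℕ∞) φ)
    (hφs : HasCompactSupport φ) : ∫ z, lap φ z = 0 := by
  have h := integral_lap hφ hφs (u := fun _ ↦ 1) (u₁ := fun _ _ ↦ 0) (u₂ := fun _ _ ↦ 0)
    (by fun_prop) (by fun_prop) (by fun_prop)
    (fun v z ↦ by simpa [HasLineDerivAt] using hasDerivAt_const (0 : ℝ) (1 : ℝ))
    (fun v z ↦ by simpa [HasLineDerivAt] using hasDerivAt_const (0 : ℝ) (0 : ℝ))
  simpa using h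

/-- Green's identity for the regularised logarithm `½ log (‖z - a‖² + ε²)`. -/
lemma integral_log_add_sq_mul_lap {φ : ℂ → ℝ} (hφ : ContDiff ℝ (⊤ : ℕ∞) φ)
    (hφs : HasCompactSupport φ) (a : ℂ) {ε : ℝ} (hε : 0 < ε) :
    ∫ z, 1 / 2 * Real.log (‖z - a‖ ^ 2 + ε ^ 2) * lap φ z =
      ∫ z, 2 * ε ^ 2 / (‖z - a‖ ^ 2 + ε ^ 2) ^ 2 * φ z := by
  have hpos (z : ℂ) : ‖z - a‖ ^ 2 + ε ^ 2 ≠ 0 := by positivity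
  have hsd (v z : ℂ) : HasDerivAt (fun t : ℝ ↦ ‖z + t • v - a‖ ^ 2 + ε ^ 2)
      (2 * ((z - a).re * v.re + (z - a).im * v.im)) 0 := by
    have h : HasDerivAt (fun t : ℝ ↦ ((z - a).re + t * v.re) ^ 2 + ((z - a).im + t * v.im) ^ 2
        + ε ^ 2) (2 * ((z - a).re * v.re + (z - a).im * v.im)) 0 := by
      have h1 := (((hasDerivAt_id (0 : ℝ)).mul_const v.re).const_add (z - a).re).pow 2
      have h2 := (((hasDerivAt_id (0 : ℝ)).mul_const v.im).const_add (z - a).im).pow 2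
      refine ((h1.add h2).add_const (ε ^ 2)).congr_deriv ?_
      simp; ring
    refine h.congr_of_eventuallyEq (.of_forall fun t ↦ ?_)
    simp only [Complex.sq_norm, Complex.normSq_apply]
    simp
    ring
  have hld (v z : ℂ) : HasDerivAt
      (fun t : ℝ ↦ (z + t • v - a).re * v.re + (z + t • v - a).im * v.im)
      (v.re ^ 2 + v.im ^ 2) 0 := by
    have h1 := (((hasDerivAt_id (0 : ℝ)).mul_const v.re).const_add (z - a).re).mul_const v.re
    have h2 := (((hasDerivAt_id (0 : ℝ)).mul_const v.im).const_add (z - a).im).mul_const v.im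
    refine ((h1.add h2).congr_deriv (by simp; ring)).congr_of_eventuallyEq
      (.of_forall fun t ↦ ?_)
    simp
    ring
  have h := integral_lap hφ hφs (u := fun z ↦ 1 / 2 * Real.log (‖z - a‖ ^ 2 + ε ^ 2))
    (u₁ := fun v z ↦ ((z - a).re * v.re + (z - a).im * v.im) / (‖z - a‖ ^ 2 + ε ^ 2))
    (u₂ := fun v z ↦ ((v.re ^ 2 + v.im ^ 2) * (‖z - a‖ ^ 2 + ε ^ 2) -
      ((z - a).re * v.re + (z - a).im * v.im) * (2 * ((z - a).re * v.re + (z - a).im * v.im))) /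
        (‖z - a‖ ^ 2 + ε ^ 2) ^ 2)
    (by fun_prop (disch := simpa using hpos _))
    (fun v ↦ Continuous.div (by fun_prop) (by fun_prop) hpos)
    (fun v ↦ Continuous.div (by fun_prop) (by fun_prop) fun z ↦ pow_ne_zero 2 (hpos z))
    (fun v z ↦ by
      refine (((hsd v z).log (by simpa using hpos z)).const_mul (1 / 2)).congr_deriv ?_
      simp; ring)
    (fun v z ↦ by
      refine ((hld v z).div (hsd v z) (by simpa using hpos z)).congr_deriv ?_
      simp)
  rw [h]
  congr 1 with z
  congr 2
  simp only [Complex.sq_norm, Complex.normSq_apply]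
  simp
  ring

lemma integrable_two_div_one_add_sq : Integrable fun w : ℂ ↦ 2 / (1 + ‖w‖ ^ 2) ^ 2 := by
  have h := (integrable_rpow_neg_one_add_norm_sq (E := ℂ) (μ := volume) (r := 4)
    (by simp; norm_num)).const_mul 2
  refine h.congr (.of_forall fun w ↦ ?_)
  have : (0 : ℝ) < 1 + ‖w‖ ^ 2 := by positivity
  simp only
  rw [show (-(4 : ℝ) / 2) = -(2 : ℝ) by norm_num, Real.rpow_neg this.le, Real.rpow_two]
  rfl

lemma integral_two_div_one_add_sq : ∫ w : ℂ, 2 / (1 + ‖w‖ ^ 2) ^ 2 = 2 * Real.pi := by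
  have h := integral_fun_norm_addHaar (volume : Measure ℂ) fun r ↦ 2 / (1 + r ^ 2) ^ 2
  have hd (x : ℝ) : HasDerivAt (fun r : ℝ ↦ -(1 + r ^ 2)⁻¹) (x * (2 / (1 + x ^ 2) ^ 2)) x := by
    have := ((((hasDerivAt_id x).pow 2).const_add 1).inv (by simp; positivity)).neg
    refine this.congr_deriv ?_
    simp; ring
  have ht : Tendsto (fun r : ℝ ↦ -(1 + r ^ 2)⁻¹) atTop (𝓝 0) := by
    simpa using ((tendsto_atTop_add_const_left atTop (1 : ℝ)
      (tendsto_pow_atTop (α := ℝ) two_ne_zero)).inv_tendsto_atTop).neg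
  have hi := integral_Ioi_of_hasDerivAt_of_nonneg' (a := 0) (fun x _ ↦ hd x)
    (fun x hx ↦ mul_nonneg (le_of_lt hx) (by positivity)) ht
  rw [h]
  simp only [Complex.finrank_real_complex, Nat.add_one_sub_one, pow_one, smul_eq_mul, hi]
  simp [Measure.real]

/-- The logarithmic potential inverts the Laplacian on test functions. -/
lemma integral_log_norm_sub_mul_lap {φ : ℂ → ℝ} (hφ : ContDiff ℝ (⊤ : ℕ∞) φ)
    (hφs : HasCompactSupport φ) (a : ℂ) :
    ∫ z, Real.log ‖z - a‖ * lap φ z = 2 * Real.pi * φ a := by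
  have hev : ∀ᶠ ε : ℝ in 𝓝[>] 0, ε ∈ Set.Ioo (0 : ℝ) 1 := Ioo_mem_nhdsGT one_pos
  have hlap := continuous_lap hφ
  have hlaps := hφs.lap
  have hne : ∀ᵐ z : ℂ, z ≠ a := by simp [ae_iff]
  have hl : Tendsto (fun ε : ℝ ↦ ∫ z, 1 / 2 * Real.log (‖z - a‖ ^ 2 + ε ^ 2) * lap φ z) (𝓝[>] 0)
      (𝓝 (∫ z, Real.log ‖z - a‖ * lap φ z)) := by
    have hb : Integrable fun z ↦ ‖Real.log ‖z - a‖ * lap φ z‖ + ‖‖z - a‖ ^ 2 * lap φ z‖ := by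
      refine (integrable_log_norm_sub_mul hlap hlaps a).norm.add (Integrable.norm ?_)
      exact Continuous.integrable_of_hasCompactSupport (by fun_prop)
        (hlaps.mul_left (f := fun z ↦ ‖z - a‖ ^ 2))
    refine tendsto_integral_filter_of_dominated_convergence _ ?_ ?_ hb ?_
    · filter_upwards [hev] with ε hε
      have hpos (z : ℂ) : ‖z - a‖ ^ 2 + ε ^ 2 ≠ 0 := by have := hε.1; positivity
      refine Continuous.aestronglyMeasurable ?_
      fun_prop (disch := simpa using hpos _)
    · filter_upwards [hev] with ε hε
      filter_upwards [hne] with z hz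
      have hp : 0 < ‖z - a‖ := norm_pos_iff.2 (sub_ne_zero.2 hz)
      have h1 : Real.log ‖z - a‖ ≤ 1 / 2 * Real.log (‖z - a‖ ^ 2 + ε ^ 2) := by
        have : Real.log (‖z - a‖ ^ 2) ≤ Real.log (‖z - a‖ ^ 2 + ε ^ 2) :=
          Real.log_le_log (by positivity) (by nlinarith [hε.1])
        rw [Real.log_pow] at this
        push_cast at this
        linarith
      have h2 : 1 / 2 * Real.log (‖z - a‖ ^ 2 + ε ^ 2) ≤ ‖z - a‖ ^ 2 := by
        have := Real.log_le_sub_one_of_pos (x := ‖z - a‖ ^ 2 + ε ^ 2) (by positivity)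
        nlinarith [hε.1, hε.2, sq_nonneg ‖z - a‖]
      rw [norm_mul (1 / 2 * _), norm_mul (Real.log _), norm_mul (‖z - a‖ ^ 2), ← add_mul]
      gcongr
      rw [Real.norm_eq_abs, Real.norm_eq_abs, Real.norm_eq_abs, abs_le]
      have := neg_abs_le (Real.log ‖z - a‖)
      have := abs_nonneg (Real.log ‖z - a‖)
      have := le_abs_self (‖z - a‖ ^ 2)
      have := abs_nonneg (‖z - a‖ ^ 2)
      constructor <;> linarith
    · filter_upwards [hne] with z hz
      have hp : ‖z - a‖ ≠ 0 := norm_ne_zero_iff.2 (sub_ne_zero.2 hz)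
      refine Tendsto.mul_const _ (tendsto_nhdsWithin_of_tendsto_nhds ?_)
      have hc : ContinuousAt (fun ε : ℝ ↦ 1 / 2 * Real.log (‖z - a‖ ^ 2 + ε ^ 2)) 0 := by
        fun_prop (disch := simpa using hp)
      have := hc.tendsto
      convert this using 2
      simp [Real.log_pow]
  have hr : Tendsto (fun ε : ℝ ↦ ∫ w, 2 / (1 + ‖w‖ ^ 2) ^ 2 * φ (a + ε • w)) (𝓝[>] 0)
      (𝓝 (∫ w : ℂ, 2 / (1 + ‖w‖ ^ 2) ^ 2 * φ a)) := by
    obtain ⟨M, hM⟩ := hφs.exists_bound_of_continuous hφ.continuous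
    have hφc := hφ.continuous
    have hpos (w : ℂ) : (1 + ‖w‖ ^ 2) ^ 2 ≠ 0 := by positivity
    refine tendsto_integral_filter_of_dominated_convergence
      (fun w ↦ 2 / (1 + ‖w‖ ^ 2) ^ 2 * M) (.of_forall fun ε ↦ ?_)
      (.of_forall fun ε ↦ .of_forall fun w ↦ ?_) (integrable_two_div_one_add_sq.mul_const M)
      (.of_forall fun w ↦ ?_)
    · refine Continuous.aestronglyMeasurable (Continuous.mul ?_ (by fun_prop))
      exact Continuous.div (by fun_prop) (by fun_prop) hpos
    · rw [norm_mul, Real.norm_of_nonneg (by positivity)]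
      gcongr
      exact hM _
    · refine Tendsto.const_mul _ (tendsto_nhdsWithin_of_tendsto_nhds ?_)
      have hc : Continuous fun ε : ℝ ↦ φ (a + ε • w) := by fun_prop
      simpa using hc.tendsto 0
  rw [integral_mul_const, integral_two_div_one_add_sq] at hr
  refine tendsto_nhds_unique (hl.congr' ?_) hr
  filter_upwards [hev] with ε hε
  have hε0 := hε.1
  rw [integral_log_add_sq_mul_lap hφ hφs a hε0]
  have e1 := integral_add_right_eq_self (μ := volume)
    (fun z ↦ 2 * ε ^ 2 / (‖z - a‖ ^ 2 + ε ^ 2) ^ 2 * φ z) a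
  have e2 := Measure.integral_comp_smul (volume : Measure ℂ)
    (fun z ↦ 2 * ε ^ 2 / (‖z + a - a‖ ^ 2 + ε ^ 2) ^ 2 * φ (z + a)) ε
  rw [← e1]
  rw [Complex.finrank_real_complex, abs_of_pos (by positivity), smul_eq_mul,
    eq_comm, inv_mul_eq_iff_eq_mul₀ (by positivity), ← integral_const_mul] at e2
  rw [e2]
  congr 1 with w
  rw [add_comm a, add_sub_cancel_right, norm_smul, Real.norm_of_nonneg hε0.le]
  have : (0 : ℝ) < 1 + ‖w‖ ^ 2 := by positivity
  field_simp
  ring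

lemma integral_log_norm_prod_mul_lap {φ : ℂ → ℝ} (hφ : ContDiff ℝ (⊤ : ℕ∞) φ)
    (hφs : HasCompactSupport φ) (S : Multiset ℂ) :
    (Integrable fun z ↦ Real.log ‖(S.map fun a ↦ z - a).prod‖ * lap φ z) ∧
      ∫ z, Real.log ‖(S.map fun a ↦ z - a).prod‖ * lap φ z = 2 * Real.pi * (S.map φ).sum := by
  induction S using Multiset.induction_on with
  | empty => simp
  | cons a S ih =>
    have hne : ∀ᵐ z : ℂ, ∀ b ∈ a ::ₘ S, z ≠ b := by
      have : {z : ℂ | ¬ ∀ b ∈ a ::ₘ S, z ≠ b} = ((a ::ₘ S).toFinset : Set ℂ) := by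
        ext z; simp [or_iff_not_imp_left]
      rw [ae_iff, this]
      exact (Finset.finite_toSet _).measure_zero _
    have he : (fun z ↦ Real.log ‖((a ::ₘ S).map fun a ↦ z - a).prod‖ * lap φ z) =ᵐ[volume]
        fun z ↦ Real.log ‖z - a‖ * lap φ z + Real.log ‖(S.map fun a ↦ z - a).prod‖ * lap φ z := by
      filter_upwards [hne] with z hz
      have h1 : ‖z - a‖ ≠ 0 := norm_ne_zero_iff.2 (sub_ne_zero.2 (hz a (by simp)))
      have h2 : ‖(S.map fun a ↦ z - a).prod‖ ≠ 0 := by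
        refine norm_ne_zero_iff.2 (Multiset.prod_ne_zero fun h0 ↦ ?_)
        obtain ⟨b, hb, hb0⟩ := Multiset.mem_map.1 h0
        exact hz b (by simp [hb]) (sub_eq_zero.1 hb0)
      rw [Multiset.map_cons, Multiset.prod_cons, norm_mul, Real.log_mul h1 h2, add_mul]
    have hi := integrable_log_norm_sub_mul (continuous_lap hφ) hφs.lap a
    refine ⟨(hi.add ih.1).congr he.symm, ?_⟩
    rw [integral_congr_ae he, integral_add hi ih.1, ih.2, integral_log_norm_sub_mul_lap hφ hφs,
      Multiset.map_cons, Multiset.sum_cons, mul_add]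

/-- The Poincaré–Lelong formula for a polynomial in one variable. -/
lemma integral_log_norm_eval_mul_lap {φ : ℂ → ℝ} (hφ : ContDiff ℝ (⊤ : ℕ∞) φ)
    (hφs : HasCompactSupport φ) {f : Polynomial ℂ} (hf : f ≠ 0) :
    (Integrable fun z ↦ Real.log ‖f.eval z‖ * lap φ z) ∧
      ∫ z, Real.log ‖f.eval z‖ * lap φ z = 2 * Real.pi * (f.roots.map φ).sum := by
  obtain ⟨h1, h2⟩ := integral_log_norm_prod_mul_lap hφ hφs f.roots
  have hl : Integrable (lap φ) := (continuous_lap hφ).integrable_of_hasCompactSupport hφs.lap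
  have he : (fun z ↦ Real.log ‖f.eval z‖ * lap φ z) =ᵐ[volume]
      fun z ↦ Real.log ‖f.leadingCoeff‖ * lap φ z +
        Real.log ‖(f.roots.map fun a ↦ z - a).prod‖ * lap φ z := by
    have hne : ∀ᵐ z : ℂ, f.eval z ≠ 0 := by
      have : {z : ℂ | ¬ f.eval z ≠ 0} = (f.roots.toFinset : Set ℂ) := by
        ext z; simp [hf]
      rw [ae_iff, this]
      exact (Finset.finite_toSet _).measure_zero _
    filter_upwards [hne] with z hz
    have h3 : f.eval z = f.leadingCoeff * (f.roots.map fun a ↦ z - a).prod :=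
      (IsAlgClosed.splits f).eval_eq_prod_roots z
    rw [h3, mul_ne_zero_iff] at hz
    rw [h3, norm_mul, Real.log_mul (norm_ne_zero_iff.2 hz.1) (norm_ne_zero_iff.2 hz.2), add_mul]
  refine ⟨((hl.const_mul _).add h1).congr he.symm, ?_⟩
  rw [integral_congr_ae he, integral_add (hl.const_mul _) h1, h2, integral_const_mul,
    integral_lap_eq_zero hφ hφs, mul_zero, zero_add]

lemma lintegral_gammaC_density (n : ℕ) :
    ∫⁻ c : EuclideanSpace ℂ (Fin n),
      ENNReal.ofReal ((Real.pi ^ n)⁻¹ * Real.exp (-‖c‖ ^ 2)) = 1 := by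
  have h : ∫ c : EuclideanSpace ℂ (Fin n), Real.exp (-‖c‖ ^ 2) = Real.pi ^ n := by
    have := GaussianFourier.integral_rexp_neg_mul_sq_norm (V := EuclideanSpace ℂ (Fin n)) one_pos
    have hf : Module.finrank ℝ (EuclideanSpace ℂ (Fin n)) = 2 * n := by
      rw [← Module.finrank_mul_finrank ℝ ℂ, Complex.finrank_real_complex, finrank_euclideanSpace,
        Fintype.card_fin]
    simpa [hf] using this
  have hpi : 0 < Real.pi ^ n := by have := Real.pi_pos; positivity
  have hi : Integrable fun c : EuclideanSpace ℂ (Fin n) ↦ Real.exp (-‖c‖ ^ 2) := by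
    by_contra h'
    rw [integral_undef h'] at h
    exact hpi.ne h
  rw [← ofReal_integral_eq_lintegral_ofReal (hi.const_mul _)
    (.of_forall fun c ↦ by positivity), integral_const_mul, h, inv_mul_cancel₀ hpi.ne',
    ENNReal.ofReal_one]

instance (n : ℕ) : IsProbabilityMeasure (gammaC n) where
  measure_univ := by
    rw [gammaC, withDensity_apply _ MeasurableSet.univ, setLIntegral_univ,
      lintegral_gammaC_density]

lemma inv_pi_mul_integral_exp_neg_sq : Real.pi⁻¹ * ∫ z : ℂ, Real.exp (-‖z‖ ^ 2) = 1 := by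
  have h := Complex.integral_rpow_mul_exp_neg_rpow (p := 2) (q := 0) (by norm_num) (by norm_num)
  simp only [Real.rpow_two, Real.rpow_zero, one_mul] at h
  rw [h]
  simp

lemma lintegral_pi_gaussian {n : ℕ} (i₀ : Fin n) {g : ℂ → ℝ} (hg : ∀ z, 0 ≤ g z)
    (hgi : Integrable fun z ↦ g z * Real.exp (-‖z‖ ^ 2)) :
    ∫⁻ x : Fin n → ℂ, ENNReal.ofReal ((Real.pi ^ n)⁻¹ *
        Real.exp (-‖(WithLp.toLp 2 x : EuclideanSpace ℂ (Fin n))‖ ^ 2)) * ENNReal.ofReal (g (x i₀)) =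
      ENNReal.ofReal (Real.pi⁻¹ * ∫ z, g z * Real.exp (-‖z‖ ^ 2)) := by
  have hpi := Real.pi_pos
  let h : Fin n → ℂ → ℝ := fun i z ↦
    Real.pi⁻¹ * ((if i = i₀ then g z else 1) * Real.exp (-‖z‖ ^ 2))
  have hint (i : Fin n) : Integrable (h i) := by
    refine Integrable.const_mul ?_ _
    by_cases hi : i = i₀
    · simpa [hi] using hgi
    · simpa [hi] using integrable_exp_neg_sq
  have hprod (x : Fin n → ℂ) : ENNReal.ofReal ((Real.pi ^ n)⁻¹ *
        Real.exp (-‖(WithLp.toLp 2 x : EuclideanSpace ℂ (Fin n))‖ ^ 2)) *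
        ENNReal.ofReal (g (x i₀)) = ENNReal.ofReal (∏ i, h i (x i)) := by
    rw [← ENNReal.ofReal_mul (by positivity)]
    congr 1
    simp only [h, Finset.prod_mul_distrib, Finset.prod_const, Finset.card_univ, Fintype.card_fin,
      Finset.prod_ite_eq', Finset.mem_univ, if_true, EuclideanSpace.norm_sq_eq,
      ← Finset.sum_neg_distrib, Real.exp_sum, inv_pow]
    ring
  simp_rw [hprod]
  have hint' : Integrable fun x : Fin n → ℂ ↦ ∏ i, h i (x i) := Integrable.fintype_prod hint
  rw [← ofReal_integral_eq_lintegral_ofReal hint'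
    (.of_forall fun x ↦ Finset.prod_nonneg fun i _ ↦ ?_), integral_fintype_prod_volume_eq_prod]
  · congr 1
    rw [Finset.prod_eq_single i₀ (fun i _ hi ↦ by simp [h, hi, integral_const_mul,
      inv_pi_mul_integral_exp_neg_sq]) (by simp)]
    simp [h, integral_const_mul]
  · have : 0 ≤ (if i = i₀ then g (x i) else 1) := by split_ifs <;> simp [hg]
    positivity

lemma measurePreserving_toLp_complex {n : ℕ} (i₀ : Fin n) :
    MeasurePreserving (WithLp.toLp 2 : (Fin n → ℂ) → EuclideanSpace ℂ (Fin n)) := by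
  have hm : Measurable (WithLp.toLp 2 : (Fin n → ℂ) → EuclideanSpace ℂ (Fin n)) :=
    (PiLp.continuous_toLp 2 _).measurable
  refine ⟨hm, ?_⟩
  have hH : (Measure.map (WithLp.toLp 2 : (Fin n → ℂ) → EuclideanSpace ℂ (Fin n))
      volume).IsAddHaarMeasure :=
    (PiLp.continuousLinearEquiv 2 ℝ fun _ : Fin n ↦ ℂ).symm.isAddHaarMeasure_map volume
  obtain ⟨κ, hκ⟩ : ∃ κ : NNReal, Measure.map (WithLp.toLp 2 :
      (Fin n → ℂ) → EuclideanSpace ℂ (Fin n)) volume = κ • volume :=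
    ⟨_, Measure.isAddLeftInvariant_eq_smul _ _⟩
  have h1 := congrArg (fun μ ↦ ∫⁻ c : EuclideanSpace ℂ (Fin n),
      ENNReal.ofReal ((Real.pi ^ n)⁻¹ * Real.exp (-‖c‖ ^ 2)) ∂μ) hκ
  simp only [lintegral_smul_measure, lintegral_gammaC_density] at h1
  rw [lintegral_map (by fun_prop) hm] at h1
  have h2 := lintegral_pi_gaussian i₀ (g := fun _ ↦ 1) (by simp)
    (by simpa using integrable_exp_neg_sq)
  simp only [ENNReal.ofReal_one, mul_one, one_mul, inv_pi_mul_integral_exp_neg_sq] at h2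
  rw [h2] at h1
  rw [hκ, show κ = 1 by simpa using h1.symm, one_smul]

lemma lintegral_gammaC_coord {n : ℕ} (i₀ : Fin n) {g : ℂ → ℝ} (hgm : Measurable g)
    (hg : ∀ z, 0 ≤ g z) (hgi : Integrable fun z ↦ g z * Real.exp (-‖z‖ ^ 2)) :
    ∫⁻ c, ENNReal.ofReal (g (c i₀)) ∂(gammaC n) =
      ENNReal.ofReal (Real.pi⁻¹ * ∫ z, g z * Real.exp (-‖z‖ ^ 2)) := by
  have hc : Measurable fun c : EuclideanSpace ℂ (Fin n) ↦ c i₀ :=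
    (PiLp.continuous_apply 2 _ i₀).measurable
  have hm : Measurable fun c : EuclideanSpace ℂ (Fin n) ↦ ENNReal.ofReal (g (c i₀)) :=
    (hgm.comp hc).ennreal_ofReal
  rw [gammaC, lintegral_withDensity_eq_lintegral_mul _ (by fun_prop) hm,
    ← (measurePreserving_toLp_complex i₀).lintegral_comp (by
      exact Measurable.mul (by fun_prop) hm), ← lintegral_pi_gaussian i₀ hg hgi]
  rfl

/-- Unitary invariance of the complex Gaussian measure. -/
lemma measurePreserving_gammaC {n : ℕ}
    (T : EuclideanSpace ℂ (Fin n) ≃ₗᵢ[ℂ] EuclideanSpace ℂ (Fin n)) :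
    MeasurePreserving T (gammaC n) (gammaC n) := by
  let T' : EuclideanSpace ℂ (Fin n) ≃ₗᵢ[ℝ] EuclideanSpace ℂ (Fin n) :=
    { toLinearEquiv := T.toLinearEquiv.restrictScalars ℝ
      norm_map' := T.norm_map }
  have hT : MeasurePreserving T volume volume := T'.measurePreserving
  refine ⟨hT.measurable, Measure.ext fun s hs ↦ ?_⟩
  rw [Measure.map_apply hT.measurable hs, gammaC, withDensity_apply _ hs,
    withDensity_apply _ (hT.measurable hs), ← hT.setLIntegral_comp_preimage hs (by fun_prop)]
  simp [T.norm_map]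

lemma lintegral_gammaC_inner {n : ℕ} (i₀ : Fin n) {u : EuclideanSpace ℂ (Fin n)} (hu : ‖u‖ = 1)
    {g : ℂ → ℝ} (hgm : Measurable g) (hg : ∀ z, 0 ≤ g z)
    (hgi : Integrable fun z ↦ g z * Real.exp (-‖z‖ ^ 2)) :
    ∫⁻ c, ENNReal.ofReal (g (inner ℂ u c)) ∂(gammaC n) =
      ENNReal.ofReal (Real.pi⁻¹ * ∫ z, g z * Real.exp (-‖z‖ ^ 2)) := by
  obtain ⟨b, hb⟩ := Orthonormal.exists_orthonormalBasis_extension_of_card_eq (𝕜 := ℂ)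
    (E := EuclideanSpace ℂ (Fin n)) (ι := Fin n) (by simp) (v := fun _ ↦ u) (s := {i₀})
    (by
      refine ⟨fun _ ↦ by simpa using hu, fun i j hij ↦ (hij (Subsingleton.elim i j)).elim⟩)
  have hc : Measurable fun c : EuclideanSpace ℂ (Fin n) ↦ c i₀ :=
    (PiLp.continuous_apply 2 _ i₀).measurable
  have h := (measurePreserving_gammaC b.repr).lintegral_comp (hgm.comp hc).ennreal_ofReal
  simp only [Function.comp_apply] at h
  rw [← lintegral_gammaC_coord i₀ hgm hg hgi, ← h]
  simp [b.repr_apply_apply, hb i₀ rfl]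

lemma sum_mul_eq_inner {n : ℕ} (w c : EuclideanSpace ℂ (Fin n)) :
    ∑ j, c j * w j = inner ℂ (WithLp.toLp 2 fun j ↦ star (w j)) c := by
  simp [PiLp.inner_apply]

lemma ae_sum_mul_ne_zero {n : ℕ} {w : EuclideanSpace ℂ (Fin n)} (hw : w ≠ 0) :
    ∀ᵐ c ∂(gammaC n), ∑ j, c j * w j ≠ 0 := by
  refine (withDensity_absolutelyContinuous volume _).ae_le ?_
  simp_rw [sum_mul_eq_inner]
  set w' : EuclideanSpace ℂ (Fin n) := WithLp.toLp 2 fun j ↦ star (w j) with hw'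
  let ℓ : EuclideanSpace ℂ (Fin n) →ₗ[ℝ] ℂ := (innerₛₗ ℂ w').restrictScalars ℝ
  have hne : w' ≠ 0 := by
    intro h
    refine hw (PiLp.ext fun j ↦ ?_)
    simpa [hw'] using congrArg (fun v : EuclideanSpace ℂ (Fin n) ↦ v j) h
  have := Measure.addHaar_submodule volume (LinearMap.ker ℓ) fun h ↦ by
    have h1 : w' ∈ LinearMap.ker ℓ := h ▸ Submodule.mem_top
    exact hne (inner_self_eq_zero.1 (LinearMap.mem_ker.1 h1))
  change ∀ᵐ c ∂volume, inner ℂ w' c ≠ 0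
  rw [ae_iff]
  convert this using 2
  ext c
  simp [ℓ]

/-- The second moment of the normalised log-modulus of a Gaussian linear form is universal. -/
lemma lintegral_sq_log_gammaC {n : ℕ} {w : EuclideanSpace ℂ (Fin n)} (hw : w ≠ 0) :
    ∫⁻ c, ENNReal.ofReal ((Real.log ‖∑ j, c j * w j‖ - Real.log ‖w‖) ^ 2) ∂(gammaC n) =
      ENNReal.ofReal (Real.pi⁻¹ * ∫ z : ℂ, Real.log ‖z‖ ^ 2 * Real.exp (-‖z‖ ^ 2)) := by
  obtain ⟨i₀⟩ : Nonempty (Fin n) := by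
    by_contra h
    rw [not_nonempty_iff] at h
    exact hw (Subsingleton.elim _ _)
  set w' : EuclideanSpace ℂ (Fin n) := WithLp.toLp 2 fun j ↦ star (w j) with hw'
  have hn : ‖w'‖ = ‖w‖ := by simp [EuclideanSpace.norm_eq, hw']
  have hw0 : ‖w‖ ≠ 0 := norm_ne_zero_iff.2 hw
  have hu : ‖((‖w‖ : ℂ)⁻¹) • w'‖ = 1 := by
    rw [norm_smul, hn]; simp [hw0]
  rw [← lintegral_gammaC_inner i₀ hu (g := fun z ↦ Real.log ‖z‖ ^ 2)
    ((Real.measurable_log.comp measurable_norm).pow_const 2) (fun z ↦ sq_nonneg _)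
    integrable_sq_log_norm_mul_exp_neg_sq]
  refine lintegral_congr_ae ?_
  filter_upwards [ae_sum_mul_ne_zero hw] with c hc
  rw [inner_smul_left, ← sum_mul_eq_inner, norm_mul,
    Real.log_mul (by simpa using hw0) (norm_ne_zero_iff.2 hc)]
  simp
  ring_nf

/-- The Cauchy–Schwarz inequality for a weighted integral on `ℂ`. -/
lemma sq_integral_mul_le {y l : ℂ → ℝ} (hym : AEStronglyMeasurable y)
    (hl : Integrable l) (hyl : Integrable fun z ↦ y z ^ 2 * |l z|) :
    (Integrable fun z ↦ y z * l z) ∧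
      (∫ z, y z * l z) ^ 2 ≤ (∫ z, |l z|) * ∫ z, y z ^ 2 * |l z| := by
  have hi : Integrable fun z ↦ y z * l z := by
    refine (hyl.add hl.norm).mono' (hym.mul hl.aestronglyMeasurable) (.of_forall fun z ↦ ?_)
    rw [norm_mul, Real.norm_eq_abs, Real.norm_eq_abs, Pi.add_apply, Real.norm_eq_abs, ← sq_abs]
    nlinarith [mul_nonneg (sq_nonneg (|y z| - 1)) (abs_nonneg (l z)), abs_nonneg (l z),
      mul_nonneg (abs_nonneg (y z)) (abs_nonneg (l z))]
  refine ⟨hi, ?_⟩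
  have hi' : Integrable fun z ↦ |y z * l z| := hi.norm
  have h1 : (∫ z, y z * l z) ^ 2 ≤ (∫ z, |y z * l z|) ^ 2 :=
    sq_le_sq.2 ((abs_integral_le_integral_abs).trans (le_abs_self _))
  have h2 : ∀ t : ℝ, 0 ≤ (∫ z, |l z|) * (t * t) + (-2 * ∫ z, |y z * l z|) * t +
      ∫ z, y z ^ 2 * |l z| := by
    intro t
    have hl' : Integrable fun z ↦ |l z| := hl.norm
    have h3 : 0 ≤ ∫ z, (|l z| * (t * t) + (-2 * |y z * l z|) * t + y z ^ 2 * |l z|) := by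
      refine integral_nonneg fun z ↦ ?_
      have : |l z| * (t * t) + (-2 * |y z * l z|) * t + y z ^ 2 * |l z| =
          |l z| * (t - |y z|) ^ 2 := by
        rw [abs_mul, ← sq_abs (y z)]; ring
      simp only [Pi.zero_apply, this]
      positivity
    have h4 : Integrable fun z ↦ |l z| * (t * t) + (-2 * |y z * l z|) * t :=
      (hl'.mul_const _).add ((hi'.const_mul _).mul_const _)
    rwa [integral_add h4 hyl,
      integral_add (hl'.mul_const _) ((hi'.const_mul _).mul_const _), integral_mul_const,
      integral_mul_const, integral_const_mul] at h3
  have h4 := discrim_le_zero h2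
  rw [discrim] at h4
  linarith

/-- The second moment `E[(log |ξ|)²]` of a standard complex Gaussian `ξ`. -/
noncomputable def logMoment : ℝ :=
  Real.pi⁻¹ * ∫ z : ℂ, Real.log ‖z‖ ^ 2 * Real.exp (-‖z‖ ^ 2)

lemma logMoment_nonneg : 0 ≤ logMoment :=
  mul_nonneg (inv_nonneg.2 Real.pi_pos.le) (integral_nonneg fun z ↦ by positivity)

/-- The linear statistic of the roots of a Gaussian random polynomial has variance bounded by the
square of the `L¹` norm of the Laplacian of the test function. -/
lemma variance_sum_roots_le {U : Set ℂ} {n : ℕ} {p : Fin n → Polynomial ℂ}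
    (hp : ∀ z ∈ U, ∃ j, (p j).eval z ≠ 0) {φ : ℂ → ℝ} (hφ : ContDiff ℝ (⊤ : ℕ∞) φ)
    (hφs : HasCompactSupport φ) (hφU : tsupport φ ⊆ U) :
    MemLp (fun c : EuclideanSpace ℂ (Fin n) ↦ ((∑ j, c j • p j).roots.map φ).sum) 2 (gammaC n) ∧
      ProbabilityTheory.variance
        (fun c : EuclideanSpace ℂ (Fin n) ↦ ((∑ j, c j • p j).roots.map φ).sum) (gammaC n) ≤
        logMoment / (2 * Real.pi) ^ 2 * (∫ z, |lap φ z|) ^ 2 := by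
  rcases U.eq_empty_or_nonempty with rfl | ⟨z₀, hz₀⟩
  · have h0 : φ = 0 := by
      have := Set.subset_empty_iff.1 hφU
      rwa [tsupport_eq_empty_iff] at this
    have h1 (S : Multiset ℂ) : (S.map (0 : ℂ → ℝ)).sum = 0 := by
      refine Multiset.sum_eq_zero fun x hx ↦ ?_
      obtain ⟨_, _, rfl⟩ := Multiset.mem_map.1 hx
      rfl
    simp only [h0, h1]
    refine ⟨memLp_const 0, ?_⟩
    have := logMoment_nonneg
    rw [show (fun _ : EuclideanSpace ℂ (Fin n) ↦ (0 : ℝ)) = 0 from rfl,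
      ProbabilityTheory.variance_zero]
    positivity
  have hLc := continuous_lap hφ
  have hL : Integrable (lap φ) := hLc.integrable_of_hasCompactSupport hφs.lap
  have hLa : Integrable fun z ↦ |lap φ z| := hL.norm
  have hLU (z : ℂ) (hz : lap φ z ≠ 0) : z ∈ U :=
    hφU (tsupport_lap_subset φ (subset_tsupport _ hz))
  let w : ℂ → EuclideanSpace ℂ (Fin n) := fun z ↦ WithLp.toLp 2 fun j ↦ (p j).eval z
  have hw : Continuous w :=
    (PiLp.continuous_toLp 2 _).comp (continuous_pi fun j ↦ (p j).continuous)
  have hw0 (z : ℂ) (hz : z ∈ U) : w z ≠ 0 := by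
    obtain ⟨j, hj⟩ := hp z hz
    exact fun h ↦ hj (by simpa [w] using congrArg (fun v : EuclideanSpace ℂ (Fin n) ↦ v j) h)
  have heval (c : EuclideanSpace ℂ (Fin n)) (z : ℂ) :
      (∑ j, c j • p j).eval z = ∑ j, c j * w z j := by
    simp [w, Polynomial.eval_finsetSum]
  let Y : EuclideanSpace ℂ (Fin n) → ℂ → ℝ := fun c z ↦
    Real.log ‖∑ j, c j * w z j‖ - Real.log ‖w z‖
  have hYm : Measurable (Function.uncurry Y) := by
    have hc : Continuous fun x : EuclideanSpace ℂ (Fin n) × ℂ ↦ ∑ j, x.1 j * w x.2 j := by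
      fun_prop
    exact (Real.measurable_log.comp hc.norm.measurable).sub
      (Real.measurable_log.comp (hw.norm.measurable.comp measurable_snd))
  have hYc (c : EuclideanSpace ℂ (Fin n)) : Measurable (Y c) := hYm.of_uncurry_left
  have hYz (z : ℂ) : Measurable fun c ↦ Y c z := hYm.of_uncurry_right
  have hlin (z : ℂ) : ∫⁻ c, ENNReal.ofReal (Y c z ^ 2 * |lap φ z|) ∂(gammaC n) =
      ENNReal.ofReal logMoment * ENNReal.ofReal |lap φ z| := by
    rcases eq_or_ne (lap φ z) 0 with hz | hz
    · simp [hz]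
    · simp_rw [ENNReal.ofReal_mul (sq_nonneg _)]
      rw [lintegral_mul_const _ ((hYz z).pow_const 2).ennreal_ofReal]
      congr 1
      exact lintegral_sq_log_gammaC (hw0 z (hLU z hz))
  have hmom : ∫⁻ c, (∫⁻ z, ENNReal.ofReal (Y c z ^ 2 * |lap φ z|)) ∂(gammaC n) =
      ENNReal.ofReal (logMoment * ∫ z, |lap φ z|) := by
    have hm : Measurable (Function.uncurry fun (c : EuclideanSpace ℂ (Fin n)) (z : ℂ) ↦
        ENNReal.ofReal (Y c z ^ 2 * |lap φ z|)) :=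
      ((hYm.pow_const 2).mul (hLc.abs.measurable.comp measurable_snd)).ennreal_ofReal
    rw [lintegral_lintegral_swap hm.aemeasurable]
    simp_rw [hlin]
    rw [lintegral_const_mul _ hLc.abs.measurable.ennreal_ofReal,
      ENNReal.ofReal_mul logMoment_nonneg,
      ofReal_integral_eq_lintegral_ofReal hLa (.of_forall fun z ↦ abs_nonneg _)]
  have hsq (c : EuclideanSpace ℂ (Fin n)) : Measurable fun z ↦ Y c z ^ 2 * |lap φ z| :=
    ((hYc c).pow_const 2).mul hLc.abs.measurable
  have hinner : ∀ᵐ c ∂(gammaC n), Integrable fun z ↦ Y c z ^ 2 * |lap φ z| := by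
    have hm : Measurable fun c ↦ ∫⁻ z, ENNReal.ofReal (Y c z ^ 2 * |lap φ z|) :=
      Measurable.lintegral_prod_right
        (((hYm.pow_const 2).mul (hLc.abs.measurable.comp measurable_snd)).ennreal_ofReal)
    filter_upwards [ae_lt_top hm (hmom ▸ ENNReal.ofReal_ne_top)] with c hc
    exact (lintegral_ofReal_ne_top_iff_integrable (hsq c).aestronglyMeasurable
      (.of_forall fun z ↦ by positivity)).1 hc.ne
  let Z : EuclideanSpace ℂ (Fin n) → ℝ := fun c ↦ ∫ z, Y c z * lap φ z
  have hZm : StronglyMeasurable Z :=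
    (hYm.mul (hLc.measurable.comp measurable_snd)).stronglyMeasurable.integral_prod_right
  have hI0 : 0 ≤ ∫ z, |lap φ z| := integral_nonneg fun z ↦ abs_nonneg _
  have hZ2 : ∫⁻ c, ENNReal.ofReal (Z c ^ 2) ∂(gammaC n) ≤
      ENNReal.ofReal (logMoment * (∫ z, |lap φ z|) ^ 2) := by
    calc ∫⁻ c, ENNReal.ofReal (Z c ^ 2) ∂(gammaC n)
      _ ≤ ∫⁻ c, ENNReal.ofReal (∫ z, |lap φ z|) *
          (∫⁻ z, ENNReal.ofReal (Y c z ^ 2 * |lap φ z|)) ∂(gammaC n) := by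
        refine lintegral_mono_ae ?_
        filter_upwards [hinner] with c hc
        rw [← ofReal_integral_eq_lintegral_ofReal hc (.of_forall fun z ↦ by positivity),
          ← ENNReal.ofReal_mul hI0]
        exact ENNReal.ofReal_le_ofReal
          (sq_integral_mul_le (hYc c).aestronglyMeasurable hL hc).2
      _ = _ := by
        rw [lintegral_const_mul' _ _ ENNReal.ofReal_ne_top, hmom, ← ENNReal.ofReal_mul hI0]
        congr 1
        ring
  have hZi : Integrable (fun c ↦ Z c ^ 2) (gammaC n) :=
    (lintegral_ofReal_ne_top_iff_integrable (hZm.pow 2).aestronglyMeasurable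
      (.of_forall fun c ↦ sq_nonneg _)).1 (hZ2.trans_lt ENNReal.ofReal_lt_top).ne
  have hZL : MemLp Z 2 (gammaC n) := (memLp_two_iff_integrable_sq hZm.aestronglyMeasurable).2 hZi
  have hEZ : ∫ c, Z c ^ 2 ∂(gammaC n) ≤ logMoment * (∫ z, |lap φ z|) ^ 2 := by
    have := logMoment_nonneg
    rwa [← ENNReal.ofReal_le_ofReal_iff (by positivity),
      ofReal_integral_eq_lintegral_ofReal hZi (.of_forall fun c ↦ sq_nonneg _)]
  set D : ℝ := ∫ z, Real.log ‖w z‖ * lap φ z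
  have hX : (fun c : EuclideanSpace ℂ (Fin n) ↦ ((∑ j, c j • p j).roots.map φ).sum)
      =ᵐ[gammaC n] fun c ↦ (2 * Real.pi)⁻¹ * Z c + (2 * Real.pi)⁻¹ * D := by
    filter_upwards [hinner, ae_sum_mul_ne_zero (hw0 z₀ hz₀)] with c hc hcz
    have hf : ∑ j, c j • p j ≠ 0 := fun h ↦ hcz (by rw [← heval, h, Polynomial.eval_zero])
    obtain ⟨h1, h2⟩ := integral_log_norm_eval_mul_lap hφ hφs hf
    have h3 := (sq_integral_mul_le (hYc c).aestronglyMeasurable hL hc).1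
    have h4 : Z c = 2 * Real.pi * ((∑ j, c j • p j).roots.map φ).sum - D := by
      rw [← h2, eq_sub_iff_add_eq, eq_comm, ← sub_eq_iff_eq_add']
      change _ - (∫ z, Y c z * lap φ z) = D
      rw [← integral_sub h1 h3]
      congr 1 with z
      simp only [Y, heval]
      ring
    have := Real.pi_pos
    rw [h4]
    field_simp
    ring
  refine ⟨((hZL.const_mul _).add (memLp_const _)).ae_eq hX.symm, ?_⟩
  rw [ProbabilityTheory.variance_congr hX,
    ProbabilityTheory.variance_add_const (hZL.const_mul _).aestronglyMeasurable,
    ProbabilityTheory.variance_const_mul]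
  calc (2 * Real.pi)⁻¹ ^ 2 * ProbabilityTheory.variance Z (gammaC n)
    _ ≤ (2 * Real.pi)⁻¹ ^ 2 * (logMoment * (∫ z, |lap φ z|) ^ 2) := by
      gcongr
      exact (ProbabilityTheory.variance_le_expectation_sq hZm.aestronglyMeasurable).trans hEZ
    _ = _ := by rw [inv_pow]; ring

/-- Variance of normalized zero statistics is `O(1/N²)`: there is a constant `C > 0`
such that for polynomials `p_{N,1},…,p_{N,n_N}` of degree at most `N` with no common
zero in an open set `U`, and smooth `φ` compactly supported in `U`,
`Var((1/N) ∑_{a ∈ Z(f_{N,c})} φ(a)) ≤ (C/N²)(∫_ℂ |Δφ| dλ)²`. -/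
theorem variance_bound_normalized :
    ∃ C : ℝ, 0 < C ∧ ∀ U : Set ℂ, IsOpen U →
      ∀ nN : ℕ → ℕ, (∀ N, 1 ≤ nN N) →
      ∀ p : (N : ℕ) → Fin (nN N) → Polynomial ℂ,
        (∀ N j, (p N j).natDegree ≤ N) →
        (∀ N, ∀ z ∈ U, ∃ j, (p N j).eval z ≠ 0) →
      ∀ φ : ℂ → ℝ, ContDiff ℝ (⊤ : ℕ∞) φ → HasCompactSupport φ → tsupport φ ⊆ U →
      ∀ N : ℕ, 1 ≤ N →
      (∫ c : EuclideanSpace ℂ (Fin (nN N)),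
            ((N : ℝ)⁻¹ * ((∑ j, c j • p N j).roots.map φ).sum) ^ 2 ∂(gammaC (nN N)))
          - (∫ c : EuclideanSpace ℂ (Fin (nN N)),
              (N : ℝ)⁻¹ * ((∑ j, c j • p N j).roots.map φ).sum ∂(gammaC (nN N))) ^ 2
        ≤ C / (N : ℝ) ^ 2 * (∫ z : ℂ, |lap φ z|) ^ 2 := by
  have hK : 0 ≤ logMoment / (2 * Real.pi) ^ 2 := div_nonneg logMoment_nonneg (by positivity)
  refine ⟨logMoment / (2 * Real.pi) ^ 2 + 1, by linarith, ?_⟩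
  intro U _ nN _ p _ hp φ hφ hφs hφU N _
  obtain ⟨hX, hv⟩ := variance_sum_roots_le (hp N) hφ hφs hφU
  have h := ProbabilityTheory.variance_eq_sub (hX.const_mul (N : ℝ)⁻¹)
  simp only [Pi.pow_apply] at h
  rw [← h, ProbabilityTheory.variance_const_mul]
  calc _ ≤ (N : ℝ)⁻¹ ^ 2 * ((logMoment / (2 * Real.pi) ^ 2 + 1) * (∫ z, |lap φ z|) ^ 2) := by
        gcongr
        refine hv.trans ?_
        gcongr
        linarith
    _ = _ := by rw [inv_pow]; ring
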